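/- For every closed HybCore computation term p, the set {t ∈ [0,∞) | there exists a closed value v with p, t ⇊ v} of time instants at which the evolution semantics of p is defined is downward closed in [0,∞). -/

import Mathlib

set_option autoImplicit false

open scoped NNReal ENNReal

/-! ### HybCore types and signatures -/

inductive Ty : Type where
  | nat : Ty
  | real : Ty
  | unit : Ty
  | bool : Ty
  | prod : Ty → Ty → Ty

/-- Denotation of types. -/
def Ty.den : Ty → Type
  | .nat => ℕ
  | .real => ℝ
  | .unit => Unit
  | .bool => Bool
  | .prod A B => A.den × B.den

inductive BaseTy : Type where
  | nat : BaseTy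
  | real : BaseTy
  | bool : BaseTy

def BaseTy.toTy : BaseTy → Ty
  | .nat => .nat
  | .real => .real
  | .bool => .bool

/-- A signature of typed operation symbols `f : A → B` with `B ∈ {ℕ, ℝ, 2}`,
together with their interpretation as functions between the denoted sets. -/
structure Signature : Type 1 where
  Op : Type
  dom : Op → Ty
  cod : Op → BaseTy
  interp : (f : Op) → (dom f).den → ((cod f).toTy).den

/-! ### Terms -/

abbrev Ctx := List Ty

inductive Var : Ctx → Ty → Type where
  | here {Γ : Ctx} {A : Ty} : Var (A :: Γ) A
  | there {Γ : Ctx} {A B : Ty} : Var Γ A → Var (B :: Γ) A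

/-- Value terms in context (a constant is included for each real number, so
that time instants can be substituted for variables of type `ℝ`). -/
inductive Val (σ : Signature) : Ctx → Ty → Type where
  | var {Γ : Ctx} {A : Ty} : Var Γ A → Val σ Γ A
  | star {Γ : Ctx} : Val σ Γ .unit
  | tt {Γ : Ctx} : Val σ Γ .bool
  | ff {Γ : Ctx} : Val σ Γ .bool
  | realC {Γ : Ctx} : ℝ → Val σ Γ .real
  | pair {Γ : Ctx} {A B : Ty} : Val σ Γ A → Val σ Γ B → Val σ Γ (.prod A B)
  | app {Γ : Ctx} (f : σ.Op) : Val σ Γ (σ.dom f) → Val σ Γ ((σ.cod f).toTy)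

/-- Computation terms in context: `now v`, pattern matching, if-then-else,
sequencing, while-loops and trajectory abstraction. -/
inductive Comp (σ : Signature) : Ctx → Ty → Type where
  | now {Γ : Ctx} {A : Ty} : Val σ Γ A → Comp σ Γ A
  | pm {Γ : Ctx} {A B C : Ty} :
      Val σ Γ (.prod A B) → Comp σ (A :: B :: Γ) C → Comp σ Γ C
  | cond {Γ : Ctx} {A : Ty} : Val σ Γ .bool → Comp σ Γ A → Comp σ Γ A → Comp σ Γ A
  | seq {Γ : Ctx} {A B : Ty} : Comp σ Γ A → Comp σ (A :: Γ) B → Comp σ Γ B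
  | wh {Γ : Ctx} {A : Ty} :
      Comp σ Γ A → Val σ (A :: Γ) .bool → Comp σ (A :: Γ) A → Comp σ Γ A
  | traj {Γ : Ctx} {A : Ty} :
      Val σ (.real :: Γ) A → Val σ (A :: Γ) .bool → Comp σ Γ A

/-! ### Substitution of closed values -/

def Var.remove : {Γ : Ctx} → {A : Ty} → Var Γ A → Ctx
  | _ :: Γ, _, .here => Γ
  | B :: _, _, .there x => B :: Var.remove x

def weakenVal {σ : Signature} {Γ : Ctx} : {A : Ty} → Val σ [] A → Val σ Γ A
  | _, .var x => nomatch x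
  | _, .star => .star
  | _, .tt => .tt
  | _, .ff => .ff
  | _, .realC r => .realC r
  | _, .pair a b => .pair (weakenVal a) (weakenVal b)
  | _, .app f a => .app f (weakenVal a)

def Var.compare : {Γ : Ctx} → {A B : Ty} → (x : Var Γ A) → (y : Var Γ B) →
    PSum (B = A) (Var x.remove B)
  | _, _, _, .here, .here => .inl rfl
  | _, _, _, .here, .there y' => .inr y'
  | _, _, _, .there _, .here => .inr .here
  | _, _, _, .there x', .there y' =>
      match Var.compare x' y' with
      | .inl h => .inl h
      | .inr z => .inr (.there z)

/-- Substitution of a closed value for a variable in a value term. -/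
def substVal {σ : Signature} {A : Ty} (v : Val σ [] A) :
    {Γ : Ctx} → {B : Ty} → Val σ Γ B → (x : Var Γ A) → Val σ x.remove B
  | _, _, .var y, x =>
      match Var.compare x y with
      | .inl rfl => weakenVal v
      | .inr z => .var z
  | _, _, .star, _ => .star
  | _, _, .tt, _ => .tt
  | _, _, .ff, _ => .ff
  | _, _, .realC r, _ => .realC r
  | _, _, .pair a b, x => .pair (substVal v a x) (substVal v b x)
  | _, _, .app f a, x => .app f (substVal v a x)

/-- Substitution of a closed value for a variable in a computation term. -/
def substComp {σ : Signature} {A : Ty} (v : Val σ [] A) :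
    {Γ : Ctx} → {B : Ty} → Comp σ Γ B → (x : Var Γ A) → Comp σ x.remove B
  | _, _, .now w, x => .now (substVal v w x)
  | _, _, .pm w k, x => .pm (substVal v w x) (substComp v k (.there (.there x)))
  | _, _, .cond b p q, x => .cond (substVal v b x) (substComp v p x) (substComp v q x)
  | _, _, .seq p q, x => .seq (substComp v p x) (substComp v q (.there x))
  | _, _, .wh p b q, x =>
      .wh (substComp v p x) (substVal v b (.there x)) (substComp v q (.there x))
  | _, _, .traj h b, x => .traj (substVal v h (.there x)) (substVal v b (.there x))

/-- `q[v/x]` for the head variable. -/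
def Comp.inst {σ : Signature} {Γ : Ctx} {A B : Ty}
    (q : Comp σ (A :: Γ) B) (v : Val σ [] A) : Comp σ Γ B :=
  substComp v q .here

def Val.inst {σ : Signature} {Γ : Ctx} {A B : Ty}
    (w : Val σ (A :: Γ) B) (v : Val σ [] A) : Val σ Γ B :=
  substVal v w .here

/-- `p[v/x, w/y]` for pattern matching. -/
def Comp.inst2 {σ : Signature} {Γ : Ctx} {A B C : Ty}
    (k : Comp σ (A :: B :: Γ) C) (va : Val σ [] A) (vb : Val σ [] B) : Comp σ Γ C :=
  (k.inst va).inst vb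

/-! ### Denotation of values -/

def Env : Ctx → Type
  | [] => Unit
  | A :: Γ => A.den × Env Γ

def Var.lookup : {Γ : Ctx} → {A : Ty} → Var Γ A → Env Γ → A.den
  | _, _, .here, ρ => ρ.1
  | _, _, .there x, ρ => Var.lookup x ρ.2

def Val.den {σ : Signature} : {Γ : Ctx} → {A : Ty} → Val σ Γ A → Env Γ → A.den
  | _, _, .var x, ρ => x.lookup ρ
  | _, _, .star, _ => ()
  | _, _, .tt, _ => true
  | _, _, .ff, _ => false
  | _, _, .realC r, _ => r
  | _, _, .pair a b, ρ => (a.den ρ, b.den ρ)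
  | _, _, .app f a, ρ => σ.interp f (a.den ρ)

/-! ### Trajectory abstraction: duration and guard -/

/-- The (boolean denotation of the) guard `w[v[s/t]/x]` of a trajectory
abstraction `(x := t.v) & w` at time instant `s`. -/
def trajGuard {σ : Signature} {A : Ty}
    (h : Val σ [Ty.real] A) (b : Val σ [A] Ty.bool) (s : ℝ) : Bool :=
  (b.inst (h.inst (.realC s))).den ()

/-- The duration `sup {e ∣ ∀ s ∈ [0,e], w[v[s/t]/x] = true}` of a trajectory
abstraction `(x := t.v) & w`. -/
noncomputable def trajDur {σ : Signature} {A : Ty}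
    (h : Val σ [Ty.real] A) (b : Val σ [A] Ty.bool) : ℝ≥0∞ :=
  sSup {e : ℝ≥0∞ | ∀ s : ℝ≥0, (s : ℝ≥0∞) ≤ e → trajGuard h b (s : ℝ) = true}

/-- A trajectory abstraction terminates iff its duration `d` is finite and the
guard holds at `d`. -/
noncomputable def trajStops {σ : Signature} {A : Ty}
    (h : Val σ [Ty.real] A) (b : Val σ [A] Ty.bool) : Prop :=
  ∃ d : ℝ≥0, trajDur h b = (d : ℝ≥0∞) ∧ trajGuard h b (d : ℝ) = true

/-! ### Big-step duration semantics (Figure 3) -/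

mutual
  /-- `p ⇓ d` : divergence in time `d ∈ [0,∞]`. -/
  inductive BigDiv {σ : Signature} : {A : Ty} → Comp σ [] A → ℝ≥0∞ → Prop where
    | pm {A B C : Ty} {v : Val σ [] A} {w : Val σ [] B} {k : Comp σ [A, B] C} {d : ℝ≥0∞} :
        BigDiv (k.inst2 v w) d → BigDiv (.pm (.pair v w) k) d
    | condT {A : Ty} {v : Val σ [] .bool} {p q : Comp σ [] A} {d : ℝ≥0∞} :
        v.den () = true → BigDiv p d → BigDiv (.cond v p q) d
    | condF {A : Ty} {v : Val σ [] .bool} {p q : Comp σ [] A} {d : ℝ≥0∞} :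
        v.den () = false → BigDiv q d → BigDiv (.cond v p q) d
    | seq1 {A B : Ty} {p : Comp σ [] A} {q : Comp σ [A] B} {d : ℝ≥0∞} :
        BigDiv p d → BigDiv (p.seq q) d
    | seq2 {A B : Ty} {p : Comp σ [] A} {q : Comp σ [A] B}
        {d : ℝ≥0} {v : Val σ [] A} {e : ℝ≥0∞} :
        BigConv p d v → BigDiv (q.inst v) e → BigDiv (p.seq q) ((d : ℝ≥0∞) + e)
    | traj {A : Ty} {h : Val σ [Ty.real] A} {b : Val σ [A] Ty.bool} :
        ¬ trajStops h b → BigDiv (.traj h b) (trajDur h b)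
    | wh1 {A : Ty} {p : Comp σ [] A} {b : Val σ [A] Ty.bool} {q : Comp σ [A] A} {d : ℝ≥0∞} :
        BigDiv p d → BigDiv (.wh p b q) d
    | wh3 {A : Ty} {p : Comp σ [] A} {b : Val σ [A] Ty.bool} {q : Comp σ [A] A}
        {d : ℝ≥0} {w : Val σ [] A} {r : ℝ≥0∞} :
        BigConv p d w → (b.inst w).den () = true →
        BigDiv (Comp.wh (q.inst w) b q) r → BigDiv (.wh p b q) ((d : ℝ≥0∞) + r)
    | wh5 {A : Ty} {p : Comp σ [] A} {b : Val σ [A] Ty.bool} {q : Comp σ [A] A}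
        (ws : ℕ → Val σ [] A) (ds : ℕ → ℝ≥0) :
        BigConv p (ds 0) (ws 0) →
        (∀ i : ℕ, (b.inst (ws i)).den () = true) →
        (∀ i : ℕ, BigConv (q.inst (ws i)) (ds (i + 1)) (ws (i + 1))) →
        BigDiv (.wh p b q) (∑' i : ℕ, (ds i : ℝ≥0∞))

  /-- `p ⇓ d, v` : termination with closed value `v` in time `d ∈ [0,∞)`. -/
  inductive BigConv {σ : Signature} : {A : Ty} → Comp σ [] A → ℝ≥0 → Val σ [] A → Prop where
    | now {A : Ty} {v : Val σ [] A} : BigConv (.now v) 0 v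
    | pm {A B C : Ty} {v : Val σ [] A} {w : Val σ [] B} {k : Comp σ [A, B] C}
        {d : ℝ≥0} {u : Val σ [] C} :
        BigConv (k.inst2 v w) d u → BigConv (.pm (.pair v w) k) d u
    | condT {A : Ty} {v : Val σ [] .bool} {p q : Comp σ [] A} {d : ℝ≥0} {u : Val σ [] A} :
        v.den () = true → BigConv p d u → BigConv (.cond v p q) d u
    | condF {A : Ty} {v : Val σ [] .bool} {p q : Comp σ [] A} {d : ℝ≥0} {u : Val σ [] A} :
        v.den () = false → BigConv q d u → BigConv (.cond v p q) d u
    | seq {A B : Ty} {p : Comp σ [] A} {q : Comp σ [A] B}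
        {d e : ℝ≥0} {v : Val σ [] A} {w : Val σ [] B} :
        BigConv p d v → BigConv (q.inst v) e w → BigConv (p.seq q) (d + e) w
    | traj {A : Ty} {h : Val σ [Ty.real] A} {b : Val σ [A] Ty.bool} {d : ℝ≥0} :
        trajDur h b = (d : ℝ≥0∞) → trajGuard h b (d : ℝ) = true →
        BigConv (.traj h b) d (h.inst (.realC (d : ℝ)))
    | wh2 {A : Ty} {p : Comp σ [] A} {b : Val σ [A] Ty.bool} {q : Comp σ [A] A}
        {d : ℝ≥0} {w : Val σ [] A} :
        BigConv p d w → (b.inst w).den () = false → BigConv (.wh p b q) d w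
    | wh4 {A : Ty} {p : Comp σ [] A} {b : Val σ [A] Ty.bool} {q : Comp σ [A] A}
        {d r : ℝ≥0} {w u : Val σ [] A} :
        BigConv p d w → (b.inst w).den () = true →
        BigConv (Comp.wh (q.inst w) b q) r u → BigConv (.wh p b q) (d + r) u
end

/-! ### Big-step evolution semantics (Figure 6) -/

/-- `p, t ⇊ v` : the computation `p` evaluates to the closed value `v` at time
instant `t ∈ [0,∞)`. -/
inductive Ev {σ : Signature} : {A : Ty} → Comp σ [] A → ℝ≥0 → Val σ [] A → Prop where
  | now {A : Ty} {v : Val σ [] A} : Ev (.now v) 0 v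
  | pm {A B C : Ty} {v : Val σ [] A} {w : Val σ [] B} {k : Comp σ [A, B] C}
      {t : ℝ≥0} {u : Val σ [] C} :
      Ev (k.inst2 v w) t u → Ev (.pm (.pair v w) k) t u
  | condT {A : Ty} {v : Val σ [] .bool} {p q : Comp σ [] A} {t : ℝ≥0} {u : Val σ [] A} :
      v.den () = true → Ev p t u → Ev (.cond v p q) t u
  | condF {A : Ty} {v : Val σ [] .bool} {p q : Comp σ [] A} {t : ℝ≥0} {u : Val σ [] A} :
      v.den () = false → Ev q t u → Ev (.cond v p q) t u
  | seq1 {A B : Ty} {p : Comp σ [] A} {q : Comp σ [A] B} {t : ℝ≥0}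
      (vs : ℝ≥0 → Val σ [] A) (ws : ℝ≥0 → Val σ [] B) :
      (∀ s : ℝ≥0, s ≤ t → Ev p s (vs s)) →
      (∀ s : ℝ≥0, s ≤ t → Ev (q.inst (vs s)) 0 (ws s)) →
      Ev (p.seq q) t (ws t)
  | seq2 {A B : Ty} {p : Comp σ [] A} {q : Comp σ [A] B} {d : ℝ≥0} {v' : Val σ [] A}
      (vs : ℝ≥0 → Val σ [] A) (ws : ℝ≥0 → Val σ [] B) {t : ℝ≥0} {w : Val σ [] B} :
      BigConv p d v' →
      (∀ s : ℝ≥0, s ≤ d → Ev p s (vs s)) →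
      (∀ s : ℝ≥0, s ≤ d → Ev (q.inst (vs s)) 0 (ws s)) →
      Ev (q.inst (vs d)) t w →
      Ev (p.seq q) (d + t) w
  | traj1 {A : Ty} {h : Val σ [Ty.real] A} {b : Val σ [A] Ty.bool} {t : ℝ≥0} {e : ℝ≥0∞} :
      BigDiv (Comp.traj h b) e → (t : ℝ≥0∞) < e →
      Ev (.traj h b) t (h.inst (.realC (t : ℝ)))
  | traj2 {A : Ty} {h : Val σ [Ty.real] A} {b : Val σ [A] Ty.bool} {t d : ℝ≥0}
      {u : Val σ [] A} :
      BigConv (Comp.traj h b) d u → t ≤ d →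
      Ev (.traj h b) t (h.inst (.realC (t : ℝ)))
  | wh1 {A : Ty} {p : Comp σ [] A} {b : Val σ [A] Ty.bool} {q : Comp σ [A] A}
      {t : ℝ≥0} {e : ℝ≥0∞} {w : Val σ [] A} :
      BigDiv p e → Ev p t w → (t : ℝ≥0∞) < e → Ev (.wh p b q) t w
  | wh2 {A : Ty} {p : Comp σ [] A} {b : Val σ [A] Ty.bool} {q : Comp σ [A] A}
      {t d : ℝ≥0} {w' w : Val σ [] A} :
      BigConv p d w' → Ev p t w → t < d → Ev (.wh p b q) t w
  | wh3 {A : Ty} {p : Comp σ [] A} {b : Val σ [A] Ty.bool} {q : Comp σ [A] A}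
      {d : ℝ≥0} {w' w : Val σ [] A} :
      BigConv p d w' → Ev p d w → (b.inst w).den () = false →
      Ev (.wh p b q) d w
  | wh4 {A : Ty} {p : Comp σ [] A} {b : Val σ [A] Ty.bool} {q : Comp σ [A] A}
      {d t : ℝ≥0} {w' w : Val σ [] A} {u : Val σ [] A} :
      BigConv p d w' → Ev p d w → (b.inst w).den () = true →
      Ev (Comp.wh (q.inst w) b q) t u →
      Ev (.wh p b q) (d + t) u

/-- Lemma 5.1: for every closed HybCore computation term `p`, the set of time
instants at which the evolution semantics of `p` is defined is downward
closed in `[0,∞)`. -/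
theorem ev_defined_downward_closed {σ : Signature} {A : Ty} (p : Comp σ [] A) :
    IsLowerSet {t : ℝ≥0 | ∃ v : Val σ [] A, Ev p t v} := by
  intro t s hst ht
  obtain ⟨v, hv⟩ := ht
  show ∃ v, Ev p s v
  induction hv generalizing s with
  | now =>
    obtain rfl : s = 0 := le_antisymm hst zero_le
    exact ⟨_, .now⟩
  | pm _ ih => obtain ⟨u, hu⟩ := ih hst; exact ⟨u, .pm hu⟩
  | condT hb _ ih => obtain ⟨u, hu⟩ := ih hst; exact ⟨u, .condT hb hu⟩
  | condF hb _ ih => obtain ⟨u, hu⟩ := ih hst; exact ⟨u, .condF hb hu⟩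
  | seq1 vs ws hp hq _ _ =>
    exact ⟨_, .seq1 vs ws (fun r hr => hp r (hr.trans hst)) (fun r hr => hq r (hr.trans hst))⟩
  | @seq2 _ _ _ _ d _ vs ws t _ hc hp hq _ _ _ ih =>
    rcases le_total s d with h | h
    · exact ⟨_, .seq1 vs ws (fun r hr => hp r (hr.trans h)) (fun r hr => hq r (hr.trans h))⟩
    · obtain ⟨r, rfl⟩ := exists_add_of_le h
      obtain ⟨u, hu⟩ := ih (le_of_add_le_add_left hst)
      exact ⟨u, .seq2 vs ws hc hp hq hu⟩
  | traj1 hd hlt => exact ⟨_, .traj1 hd (lt_of_le_of_lt (ENNReal.coe_le_coe.2 hst) hlt)⟩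
  | traj2 hc hle => exact ⟨_, .traj2 hc (hst.trans hle)⟩
  | wh1 hd _ hlt ih =>
    obtain ⟨u, hu⟩ := ih hst
    exact ⟨u, .wh1 hd hu (lt_of_le_of_lt (ENNReal.coe_le_coe.2 hst) hlt)⟩
  | wh2 hc _ hlt ih =>
    obtain ⟨u, hu⟩ := ih hst
    exact ⟨u, .wh2 hc hu (lt_of_le_of_lt hst hlt)⟩
  | wh3 hc he hb ih =>
    rcases hst.lt_or_eq with h | rfl
    · obtain ⟨u, hu⟩ := ih hst
      exact ⟨u, .wh2 hc hu h⟩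
    · exact ⟨_, .wh3 hc he hb⟩
  | @wh4 _ _ _ _ d t _ _ _ hc he hb _ ih1 ih2 =>
    rcases lt_or_ge s d with h | h
    · obtain ⟨u, hu⟩ := ih1 h.le
      exact ⟨u, .wh2 hc hu h⟩
    · obtain ⟨r, rfl⟩ := exists_add_of_le h
      obtain ⟨u, hu⟩ := ih2 (le_of_add_le_add_left hst)
      exact ⟨u, .wh4 hc he hb hu⟩
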